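/- arXiv:1408.6359 — 2 statements merged into one kernel-verified Lean document; each statement's English description precedes it below -/
import Mathlib

section
/- Let n ≥ 2 and let 𝒜 be of nonstandard p(·)-growth with constants a₋, b⁺. Suppose there exist an increasing sequence of radii R_k → ∞ and a constant q with 1 ≤ q ≤ p⁺ such that p(x) = q for almost every x in the annulus B_{2R_k}∖B_{R_k}, for every k. If u is an 𝒜-harmonic function in ℝⁿ satisfying ∫_{ℝⁿ} |∇u(x)|^{p(x)} dx < ∞, then u is constant. -/
open MeasureTheory Metric Real
open scoped ContDiff

noncomputable section

abbrev Euc (n : ℕ) := EuclideanSpace ℝ (Fin n)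

/-- Measure of the unit ball in `ℝⁿ`. -/
def omegaEuc (n : ℕ) : ℝ := (volume (Metric.ball (0 : Euc n) 1)).toReal

/-- A measurable variable exponent `p` with `p⁻ = pm` and `p⁺ = pP`,
`1 < p⁻` and `p⁺ < ∞` (encoded by the a.e. bounds). -/
structure IsVarExp {n : ℕ} (p : Euc n → ℝ) (pm pP : ℝ) : Prop where
  meas : Measurable p
  one_lt : 1 < pm
  inf_eq : essInf p (volume : Measure (Euc n)) = pm
  sup_eq : essSup p (volume : Measure (Euc n)) = pP
  ae_lb : ∀ᵐ x ∂(volume : Measure (Euc n)), pm ≤ p x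
  ae_ub : ∀ᵐ x ∂(volume : Measure (Euc n)), p x ≤ pP

/-- `𝒜` is of nonstandard `p(·)`-growth with constants `am = a₋`, `bP = b⁺`. -/
structure IsNSGrowth {n : ℕ} (p : Euc n → ℝ) (𝒜 : Euc n → ℝ → Euc n → Euc n)
    (am bP : ℝ) : Prop where
  am_pos : 0 < am
  meas : ∀ (t : ℝ) (ξ : Euc n), Measurable (fun x => 𝒜 x t ξ)
  cont : ∀ x : Euc n, Continuous (fun tξ : ℝ × Euc n => 𝒜 x tξ.1 tξ.2)
  growth : ∃ a b : Euc n → ℝ, Measurable a ∧ Measurable b ∧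
      (∀ x, am ≤ a x ∧ a x ≤ b x ∧ b x ≤ bP) ∧
      (∀ x t ξ, a x * ‖ξ‖ ^ p x ≤ (inner ℝ (𝒜 x t ξ) ξ : ℝ)) ∧
      (∀ x t ξ, ‖𝒜 x t ξ‖ ≤ b x * ‖ξ‖ ^ (p x - 1))

/-- `u` is `𝒜`-harmonic in `ℝⁿ` (C¹ functions replace `W^{1,p(·)}_loc`). -/
def IsAHarmonic {n : ℕ} (p : Euc n → ℝ) (𝒜 : Euc n → ℝ → Euc n → Euc n)
    (u : Euc n → ℝ) : Prop :=
  ContDiff ℝ 1 u ∧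
  LocallyIntegrable (fun x => ‖gradient u x‖ ^ p x) (volume : Measure (Euc n)) ∧
  ∀ φ : Euc n → ℝ, ContDiff ℝ ∞ φ → HasCompactSupport φ →
    ∫ x, (inner ℝ (𝒜 x (u x) (gradient u x)) (gradient φ x) : ℝ) = 0

/-- `u` is an `𝒜`-subsolution in `ℝⁿ`. -/
def IsASubsolution {n : ℕ} (p : Euc n → ℝ) (𝒜 : Euc n → ℝ → Euc n → Euc n)
    (u : Euc n → ℝ) : Prop :=
  ContDiff ℝ 1 u ∧
  LocallyIntegrable (fun x => ‖gradient u x‖ ^ p x) (volume : Measure (Euc n)) ∧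
  ∀ φ : Euc n → ℝ, ContDiff ℝ ∞ φ → HasCompactSupport φ → (∀ x, 0 ≤ φ x) →
    ∫ x, (inner ℝ (𝒜 x (u x) (gradient u x)) (gradient φ x) : ℝ) ≤ 0

/-- `ℬ` is an admissible right-hand side. -/
structure IsAdmissibleRHS {n : ℕ} (p : Euc n → ℝ) (ℬ : Euc n → ℝ → Euc n → ℝ) : Prop where
  meas : ∀ (t : ℝ) (ξ : Euc n), Measurable (fun x => ℬ x t ξ)
  cont : ∀ x : Euc n, Continuous (fun tξ : ℝ × Euc n => ℬ x tξ.1 tξ.2)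
  bound : ∃ c : Euc n → ℝ, Measurable c ∧ (∃ cP : ℝ, ∀ x, c x ≤ cP) ∧
      ∀ x t ξ, |ℬ x t ξ| ≤ c x * (1 + ‖ξ‖ ^ (p x - 1))

/-- `u` is `(𝒜,ℬ)`-harmonic in `ℝⁿ`. -/
def IsABHarmonic {n : ℕ} (p : Euc n → ℝ) (𝒜 : Euc n → ℝ → Euc n → Euc n)
    (ℬ : Euc n → ℝ → Euc n → ℝ) (u : Euc n → ℝ) : Prop :=
  ContDiff ℝ 1 u ∧
  LocallyIntegrable (fun x => ‖gradient u x‖ ^ p x) (volume : Measure (Euc n)) ∧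
  ∀ φ : Euc n → ℝ, ContDiff ℝ ∞ φ → HasCompactSupport φ →
    ∫ x, (inner ℝ (𝒜 x (u x) (gradient u x)) (gradient φ x) : ℝ)
      = ∫ x, ℬ x (u x) (gradient u x) * φ x

/-- `u` is a supersolution of `div 𝒜(x,u,∇u) = f(u)` in `ℝⁿ`. -/
def IsFSupersolution {n : ℕ} (p : Euc n → ℝ) (𝒜 : Euc n → ℝ → Euc n → Euc n)
    (f : ℝ → ℝ) (u : Euc n → ℝ) : Prop :=
  ContDiff ℝ 1 u ∧
  LocallyIntegrable (fun x => ‖gradient u x‖ ^ p x) (volume : Measure (Euc n)) ∧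
  ∀ φ : Euc n → ℝ, ContDiff ℝ ∞ φ → HasCompactSupport φ → (∀ x, 0 ≤ φ x) →
    ∫ x, f (u x) * φ x ≤ - ∫ x, (inner ℝ (𝒜 x (u x) (gradient u x)) (gradient φ x) : ℝ)


section Poincare

open Set
open scoped ENNReal

variable {E : Type*} [NormedAddCommGroup E] [NormedSpace ℝ E]

lemma enorm_sub_rpow_le_lintegral_segment {u : E → ℝ} (hu : ContDiff ℝ 1 u) {q : ℝ} (hq : 1 ≤ q)
    (x z : E) :
    ‖u x - u z‖ₑ ^ q ≤
      ‖z - x‖ₑ ^ q * ∫⁻ t in Icc (0 : ℝ) 1, ‖fderiv ℝ u (x + t • (z - x))‖ₑ ^ q := by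
  have hq0 : 0 < q := by linarith
  have hcont : Continuous fun t : ℝ => fderiv ℝ u (x + t • (z - x)) :=
    (hu.continuous_fderiv one_ne_zero).comp (by fun_prop)
  have hderiv : ∀ t : ℝ, HasDerivAt (fun t : ℝ => u (x + t • (z - x)))
      (fderiv ℝ u (x + t • (z - x)) (z - x)) t := by
    intro t
    have h1 : HasDerivAt (fun t : ℝ => x + t • (z - x)) (z - x) t := by
      simpa using ((hasDerivAt_id t).smul_const (z - x)).const_add x
    exact ((hu.differentiable one_ne_zero _).hasFDerivAt).comp_hasDerivAt t h1
  have hcont' : Continuous fun t : ℝ => fderiv ℝ u (x + t • (z - x)) (z - x) :=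
    hcont.clm_apply continuous_const
  have hftc := intervalIntegral.integral_eq_sub_of_hasDerivAt (a := 0) (b := 1)
    (fun t _ => hderiv t) (hcont'.intervalIntegrable _ _)
  simp only [one_smul, add_sub_cancel, zero_smul, add_zero] at hftc
  have hle : ‖u x - u z‖ₑ ≤
      ∫⁻ t in Icc (0 : ℝ) 1, ‖fderiv ℝ u (x + t • (z - x)) (z - x)‖ₑ := by
    rw [← enorm_neg, neg_sub, ← hftc, intervalIntegral.integral_of_le zero_le_one,
      ← integral_Icc_eq_integral_Ioc]
    exact enorm_integral_le_lintegral_enorm _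
  have : IsProbabilityMeasure (volume.restrict (Icc (0 : ℝ) 1)) := ⟨by simp⟩
  have hjensen := eLpNorm'_le_eLpNorm'_of_exponent_le zero_lt_one hq
    (volume.restrict (Icc (0 : ℝ) 1)) (f := fun t => fderiv ℝ u (x + t • (z - x)) (z - x))
    hcont'.aestronglyMeasurable
  simp only [eLpNorm', ENNReal.rpow_one, div_one] at hjensen
  calc ‖u x - u z‖ₑ ^ q
      ≤ ((∫⁻ t in Icc (0 : ℝ) 1, ‖fderiv ℝ u (x + t • (z - x)) (z - x)‖ₑ ^ q) ^ (1 / q)) ^ q := by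
        gcongr
        exact hle.trans hjensen
    _ = ∫⁻ t in Icc (0 : ℝ) 1, ‖fderiv ℝ u (x + t • (z - x)) (z - x)‖ₑ ^ q := by
        rw [← ENNReal.rpow_mul, one_div_mul_cancel hq0.ne', ENNReal.rpow_one]
    _ ≤ ∫⁻ t in Icc (0 : ℝ) 1, ‖z - x‖ₑ ^ q * ‖fderiv ℝ u (x + t • (z - x))‖ₑ ^ q := by
        gcongr with t
        rw [← ENNReal.mul_rpow_of_nonneg _ _ hq0.le, mul_comm]
        gcongr
        exact ContinuousLinearMap.le_opENorm _ _
    _ = _ := by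
        rw [lintegral_const_mul]
        exact (hcont.enorm.measurable.pow_const _)


variable [MeasurableSpace E]

/-- The mean oscillation of a `C¹` function between `U` and `V`, in the `L^q` sense, is controlled
by its gradient energy in `Ω`, uniformly over all functions. -/
def OscillationControlled (μ : Measure E) (q : ℝ) (Ω U V : Set E) : Prop :=
  ∃ C : ℝ≥0∞, C ≠ ⊤ ∧ ∀ u : E → ℝ, ContDiff ℝ 1 u →
    ∫⁻ x in U, ∫⁻ z in V, ‖u x - u z‖ₑ ^ q ∂μ ∂μ ≤ C * ∫⁻ x in Ω, ‖fderiv ℝ u x‖ₑ ^ q ∂μ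

variable {μ : Measure E}

lemma OscillationControlled.mono {q : ℝ} {Ω Ω' U U' V V' : Set E}
    (h : OscillationControlled μ q Ω U V) (hΩ : Ω ⊆ Ω') (hU : U' ⊆ U) (hV : V' ⊆ V) :
    OscillationControlled μ q Ω' U' V' := by
  obtain ⟨C, hC, h⟩ := h
  refine ⟨C, hC, fun u hu => ?_⟩
  calc ∫⁻ x in U', ∫⁻ z in V', ‖u x - u z‖ₑ ^ q ∂μ ∂μ
      ≤ ∫⁻ x in U, ∫⁻ z in V, ‖u x - u z‖ₑ ^ q ∂μ ∂μ := by gcongr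
    _ ≤ _ := h u hu
    _ ≤ _ := by gcongr

lemma oscillationControlled_biUnion {ι : Type*} {q : ℝ} {Ω V : Set E} {U : ι → Set E}
    (t : Finset ι) (h : ∀ i ∈ t, OscillationControlled μ q Ω (U i) V) :
    OscillationControlled μ q Ω (⋃ i ∈ t, U i) V := by
  choose! C hC h using h
  refine ⟨∑ i ∈ t, C i, by simpa [ENNReal.sum_eq_top] using hC, fun u hu => ?_⟩
  rw [Finset.sum_mul]
  refine le_trans ?_ (Finset.sum_le_sum fun i hi => h i hi u hu)
  rw [← Finset.sum_coe_sort, ← tsum_fintype (L := .unconditional _)]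
  have e : ⋃ i ∈ t, U i = ⋃ i : t, U i := biUnion_eq_iUnion (t : Set ι) fun i _ => U i
  rw [e]
  exact lintegral_iUnion_le _ _

variable [FiniteDimensional ℝ E] [BorelSpace E] [μ.IsAddHaarMeasure]

variable (μ) in
lemma lintegral_comp_add_smul {g : E → ℝ≥0∞} (hg : Measurable g) (a : E) {t : ℝ} (ht : t ≠ 0) :
    ∫⁻ z, g (a + t • z) ∂μ = ENNReal.ofReal |(t ^ Module.finrank ℝ E)⁻¹| * ∫⁻ z, g z ∂μ := by
  have h := lintegral_map (μ := μ) (f := fun z => g (a + z)) (g := fun z => t • z)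
    (by fun_prop) (by fun_prop)
  rw [← h, Measure.map_addHaar_smul μ ht, lintegral_smul_measure, lintegral_add_left_eq_self,
    smul_eq_mul]

variable (μ) in
lemma lintegral_lintegral_segment_le_of_half_le {B : Set E} (hB : Convex ℝ B)
    (hBm : MeasurableSet B) {g : E → ℝ≥0∞} (hg : Measurable g) {t : ℝ} (ht : 1 / 2 ≤ t)
    (ht1 : t ≤ 1) :
    ∫⁻ x in B, ∫⁻ z in B, g (x + t • (z - x)) ∂μ ∂μ ≤
      2 ^ Module.finrank ℝ E * μ B * ∫⁻ x in B, g x ∂μ := by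
  have ht0 : 0 < t := by linarith
  have key : ∀ x ∈ B, ∫⁻ z in B, g (x + t • (z - x)) ∂μ ≤
      2 ^ Module.finrank ℝ E * ∫⁻ x in B, g x ∂μ := by
    intro x hx
    rw [← lintegral_indicator hBm, ← lintegral_indicator hBm]
    calc ∫⁻ z, B.indicator (fun z => g (x + t • (z - x))) z ∂μ
        ≤ ∫⁻ z, B.indicator g ((x - t • x) + t • z) ∂μ := by
          gcongr with z
          by_cases hz : z ∈ B
          swap
          · simp [hz]
          have e : x - t • x + t • z = x + t • (z - x) := by rw [smul_sub]; abel
          have hmem : x + t • (z - x) ∈ B := hB.add_smul_sub_mem hx hz ⟨ht0.le, ht1⟩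
          rw [e, indicator_of_mem hmem, indicator_of_mem hz]
      _ = ENNReal.ofReal |(t ^ Module.finrank ℝ E)⁻¹| * ∫⁻ z, B.indicator g z ∂μ :=
          lintegral_comp_add_smul μ (hg.indicator hBm) _ ht0.ne'
      _ ≤ _ := by
          gcongr
          rw [abs_of_pos (by positivity), ← inv_pow, ENNReal.ofReal_pow (by positivity)]
          gcongr
          refine ENNReal.ofReal_le_of_le_toReal ?_
          rw [ENNReal.toReal_ofNat, inv_le_comm₀ ht0 two_pos]
          linarith
  calc ∫⁻ x in B, ∫⁻ z in B, g (x + t • (z - x)) ∂μ ∂μ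
      ≤ ∫⁻ x in B, 2 ^ Module.finrank ℝ E * ∫⁻ x in B, g x ∂μ ∂μ := setLIntegral_mono' hBm key
    _ = _ := by rw [setLIntegral_const]; ring

variable (μ) in
lemma lintegral_lintegral_segment_le {B : Set E} (hB : Convex ℝ B)
    (hBm : MeasurableSet B) {g : E → ℝ≥0∞} (hg : Measurable g) {t : ℝ} (ht : t ∈ Icc (0 : ℝ) 1) :
    ∫⁻ x in B, ∫⁻ z in B, g (x + t • (z - x)) ∂μ ∂μ ≤
      2 ^ Module.finrank ℝ E * μ B * ∫⁻ x in B, g x ∂μ := by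
  rcases le_total (1 / 2) t with h | h
  · exact lintegral_lintegral_segment_le_of_half_le μ hB hBm hg h ht.2
  · rw [lintegral_lintegral_swap (by fun_prop)]
    convert lintegral_lintegral_segment_le_of_half_le μ hB hBm hg (t := 1 - t) (by linarith)
      (by linarith [ht.1]) using 5 with z x
    rw [sub_smul, one_smul, smul_sub, smul_sub]
    abel_nf

lemma OscillationControlled.symm {q : ℝ} {Ω U V : Set E}
    (h : OscillationControlled μ q Ω U V) : OscillationControlled μ q Ω V U := by
  obtain ⟨C, hC, h⟩ := h
  refine ⟨C, hC, fun u hu => ?_⟩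
  have hc := hu.continuous
  rw [lintegral_lintegral_swap (by fun_prop)]
  simpa only [enorm_sub_rev] using h u hu

lemma OscillationControlled.trans {q : ℝ} (hq : 1 ≤ q) {Ω U V W : Set E}
    (hUW : OscillationControlled μ q Ω U W) (hWV : OscillationControlled μ q Ω W V)
    (hU : μ U ≠ ⊤) (hV : μ V ≠ ⊤) (hW : μ W ≠ ⊤) (hW0 : μ W ≠ 0) :
    OscillationControlled μ q Ω U V := by
  obtain ⟨C, hC, hUW⟩ := hUW
  obtain ⟨D, hD, hWV⟩ := hWV.symm
  refine ⟨(μ W)⁻¹ * (2 ^ (q - 1) * (μ V * C + μ U * D)), ?_, fun u hu => ?_⟩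
  · have : (2 : ℝ≥0∞) ^ (q - 1) ≠ ⊤ := ENNReal.rpow_ne_top_of_nonneg (by linarith) (by simp)
    finiteness
  have hc := hu.continuous
  rw [mul_assoc, ← ENNReal.div_eq_inv_mul, ENNReal.le_div_iff_mul_le (by simp [hW0]) (by simp [hW])]
  calc (∫⁻ x in U, ∫⁻ z in V, ‖u x - u z‖ₑ ^ q ∂μ ∂μ) * μ W
      = ∫⁻ x in U, ∫⁻ z in V, ∫⁻ w in W, ‖u x - u z‖ₑ ^ q ∂μ ∂μ ∂μ := by
        simp only [setLIntegral_const]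
        rw [← lintegral_mul_const _ (by fun_prop)]
        congr! 2 with x
        rw [← lintegral_mul_const _ (by fun_prop)]
    _ ≤ ∫⁻ x in U, ∫⁻ z in V, ∫⁻ w in W,
          2 ^ (q - 1) * (‖u x - u w‖ₑ ^ q + ‖u z - u w‖ₑ ^ q) ∂μ ∂μ ∂μ := by
        gcongr with x z w
        refine le_trans ?_ (ENNReal.rpow_add_le_mul_rpow_add_rpow _ _ hq)
        gcongr
        rw [enorm_sub_rev (u z)]
        convert enorm_add_le (u x - u w) (u w - u z) using 2
        abel
    _ = 2 ^ (q - 1) * (μ V * ∫⁻ x in U, ∫⁻ w in W, ‖u x - u w‖ₑ ^ q ∂μ ∂μ) +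
          2 ^ (q - 1) * (μ U * ∫⁻ z in V, ∫⁻ w in W, ‖u z - u w‖ₑ ^ q ∂μ ∂μ) := by
        have h1 : ∀ x z, ∫⁻ w in W, 2 ^ (q - 1) * (‖u x - u w‖ₑ ^ q + ‖u z - u w‖ₑ ^ q) ∂μ =
            2 ^ (q - 1) * (∫⁻ w in W, ‖u x - u w‖ₑ ^ q ∂μ) +
            2 ^ (q - 1) * ∫⁻ w in W, ‖u z - u w‖ₑ ^ q ∂μ := by
          intro x z
          rw [lintegral_const_mul _ (by fun_prop), lintegral_add_left (by fun_prop), mul_add]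
        have hm : Measurable fun x => ∫⁻ w in W, ‖u x - u w‖ₑ ^ q ∂μ :=
          Measurable.lintegral_prod_right' (f := fun p : E × E => ‖u p.1 - u p.2‖ₑ ^ q)
            (by fun_prop)
        simp only [h1]
        have h2 : ∀ x, ∫⁻ z in V, (2 ^ (q - 1) * (∫⁻ w in W, ‖u x - u w‖ₑ ^ q ∂μ) +
            2 ^ (q - 1) * ∫⁻ w in W, ‖u z - u w‖ₑ ^ q ∂μ) ∂μ =
            (2 ^ (q - 1) * μ V) * (∫⁻ w in W, ‖u x - u w‖ₑ ^ q ∂μ) +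
            2 ^ (q - 1) * ∫⁻ z in V, ∫⁻ w in W, ‖u z - u w‖ₑ ^ q ∂μ ∂μ := by
          intro x
          rw [lintegral_add_left measurable_const, setLIntegral_const, lintegral_const_mul _ hm]
          ring
        simp only [h2]
        rw [lintegral_add_left (hm.const_mul _), lintegral_const_mul _ hm, setLIntegral_const]
        ring
    _ ≤ 2 ^ (q - 1) * (μ V * (C * ∫⁻ x in Ω, ‖fderiv ℝ u x‖ₑ ^ q ∂μ)) +
          2 ^ (q - 1) * (μ U * (D * ∫⁻ x in Ω, ‖fderiv ℝ u x‖ₑ ^ q ∂μ)) := by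
        gcongr
        · exact hUW u hu
        · exact hWV u hu
    _ = _ := by ring

lemma oscillationControlled_of_convex {q : ℝ} (hq : 1 ≤ q) {B : Set E} (hB : Convex ℝ B)
    (hBm : MeasurableSet B) (hBb : Bornology.IsBounded B) : OscillationControlled μ q B B B := by
  obtain ⟨d, hd⟩ := isBounded_iff.1 hBb
  have hq0 : 0 ≤ q := by linarith
  refine ⟨ENNReal.ofReal d ^ q * (2 ^ Module.finrank ℝ E * μ B), ?_, fun u hu => ?_⟩
  · have := hBb.measure_lt_top (μ := μ)
    finiteness
  have hcont := hu.continuous_fderiv one_ne_zero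
  set g : E → ℝ≥0∞ := fun x => ‖fderiv ℝ u x‖ₑ ^ q
  have hg : Measurable g := hcont.enorm.measurable.pow_const q
  calc ∫⁻ x in B, ∫⁻ z in B, ‖u x - u z‖ₑ ^ q ∂μ ∂μ
      ≤ ∫⁻ x in B, ∫⁻ z in B, ENNReal.ofReal d ^ q *
          (∫⁻ t in Icc (0 : ℝ) 1, g (x + t • (z - x))) ∂μ ∂μ := by
        refine setLIntegral_mono' hBm fun x hx => setLIntegral_mono' hBm fun z hz => ?_
        refine (enorm_sub_rpow_le_lintegral_segment hu hq x z).trans ?_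
        gcongr
        rw [← ofReal_norm, ← dist_eq_norm]
        exact ENNReal.ofReal_le_ofReal (hd hz hx)
    _ = ENNReal.ofReal d ^ q *
          ∫⁻ t in Icc (0 : ℝ) 1, ∫⁻ x in B, ∫⁻ z in B, g (x + t • (z - x)) ∂μ ∂μ := by
        have hm1 (x : E) : Measurable fun z => ∫⁻ t in Icc (0 : ℝ) 1, g (x + t • (z - x)) :=
          Measurable.lintegral_prod_right' (f := fun w : E × ℝ => g (x + w.2 • (w.1 - x)))
            (by fun_prop)
        have hm2 : Measurable fun y : E × ℝ => ∫⁻ z in B, g (y.1 + y.2 • (z - y.1)) ∂μ :=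
          Measurable.lintegral_prod_right'
            (f := fun w : (E × ℝ) × E => g (w.1.1 + w.1.2 • (w.2 - w.1.1))) (by fun_prop)
        have e : ∀ x, ∫⁻ z in B, ENNReal.ofReal d ^ q *
            (∫⁻ t in Icc (0 : ℝ) 1, g (x + t • (z - x))) ∂μ = ENNReal.ofReal d ^ q *
            ∫⁻ t in Icc (0 : ℝ) 1, ∫⁻ z in B, g (x + t • (z - x)) ∂μ := by
          intro x
          rw [lintegral_const_mul _ (hm1 x),
            lintegral_lintegral_swap (by fun_prop)]
        simp only [e]
        rw [lintegral_const_mul _ hm2.lintegral_prod_right', lintegral_lintegral_swap hm2.aemeasurable]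
    _ ≤ ENNReal.ofReal d ^ q * ∫⁻ t in Icc (0 : ℝ) 1,
          2 ^ Module.finrank ℝ E * μ B * ∫⁻ x in B, g x ∂μ := by
        refine mul_le_mul_right ?_ _
        exact setLIntegral_mono' measurableSet_Icc fun t ht =>
          lintegral_lintegral_segment_le μ hB hBm hg ht
    _ = _ := by simp [mul_assoc]

lemma oscillationControlled_annulus (hE : 1 < Module.rank ℝ E) {q : ℝ} (hq : 1 ≤ q) :
    ∃ V : Set E, μ V ≠ 0 ∧ μ V ≠ ⊤ ∧ OscillationControlled μ q {x | 1 < ‖x‖ ∧ ‖x‖ < 2}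
      {x | 7 / 5 ≤ ‖x‖ ∧ ‖x‖ ≤ 8 / 5} V := by
  set Ω : Set E := {x | 1 < ‖x‖ ∧ ‖x‖ < 2}
  set S : Set E := sphere 0 (3 / 2)
  have : Nontrivial E := rank_pos_iff_nontrivial.1 (zero_lt_one.trans hE)
  obtain ⟨x₀, hx₀⟩ : S.Nonempty := NormedSpace.sphere_nonempty.2 (by norm_num)
  have hpos (x : E) : μ (ball x (1 / 4)) ≠ 0 := (measure_ball_pos μ x (by norm_num)).ne'
  have hfin (x : E) : μ (ball x (1 / 4)) ≠ ⊤ := measure_ball_ne_top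
  have hlocal : ∀ x ∈ S, ∀ y, dist y x < 1 / 4 →
      OscillationControlled μ q Ω (ball x (1 / 4)) (ball y (1 / 4)) := by
    intro x hx y hy
    have hx : ‖x‖ = 3 / 2 := by simpa [S] using hx
    refine (oscillationControlled_of_convex hq (convex_ball x (1 / 2)) measurableSet_ball
      isBounded_ball).mono (fun z hz => ?_) (ball_subset_ball (by norm_num))
      (ball_subset_ball' (by linarith))
    rw [mem_ball, dist_eq_norm] at hz
    have h1 := abs_le.1 (abs_norm_sub_norm_le z x)
    constructor <;> linarith
  have hlink : ∀ y ∈ S, OscillationControlled μ q Ω (ball y (1 / 4)) (ball x₀ (1 / 4)) := by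
    intro y hy
    refine (isPreconnected_sphere hE (0 : E) (3 / 2)).induction₂
      (fun x y => OscillationControlled μ q Ω (ball x (1 / 4)) (ball y (1 / 4)))
      (fun x hx => ?_) (fun x y z _ _ _ hxy hyz => ?_) (fun x y _ _ h => h.symm) hy hx₀
    · exact Filter.Eventually.filter_mono nhdsWithin_le_nhds
        (Filter.mem_of_superset (ball_mem_nhds x (by norm_num)) (fun y hy => hlocal x hx y hy))
    · exact hxy.trans hq hyz (hfin _) (hfin _) (hfin _) (hpos _)
  obtain ⟨t, htS, htfin, htcover⟩ := finite_cover_balls_of_compact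
    (isCompact_sphere (0 : E) (3 / 2)) (e := 1 / 8) (by norm_num)
  refine ⟨ball x₀ (1 / 4), hpos _, hfin _,
    (oscillationControlled_biUnion (U := fun y => ball y (1 / 4)) htfin.toFinset
      fun y hy => hlink y (htS (by simpa using hy))).mono subset_rfl (fun x hx => ?_) subset_rfl⟩
  obtain ⟨h1, h2⟩ := hx
  have hx0 : 0 < ‖x‖ := by linarith
  have hyS : (3 / 2 / ‖x‖) • x ∈ sphere (0 : E) (3 / 2) := by
    rw [mem_sphere_zero_iff_norm, norm_smul, norm_div, norm_norm, div_mul_cancel₀ _ hx0.ne']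
    norm_num
  obtain ⟨y, hy, hxy⟩ := mem_iUnion₂.1 (htcover hyS)
  refine mem_iUnion₂.2 ⟨y, by simpa using hy, ?_⟩
  have hd : dist x ((3 / 2 / ‖x‖) • x) ≤ 1 / 10 := by
    have e : x - (3 / 2 / ‖x‖) • x = (1 - 3 / 2 / ‖x‖) • x := by rw [sub_smul, one_smul]
    rw [dist_eq_norm, e, norm_smul, Real.norm_eq_abs, ← abs_of_pos hx0, ← abs_mul,
      abs_of_pos hx0, sub_mul, div_mul_cancel₀ _ hx0.ne', abs_le]
    constructor <;> linarith
  have := dist_triangle x ((3 / 2 / ‖x‖) • x) y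
  rw [mem_ball] at hxy ⊢
  linarith

variable (μ) in
lemma setLIntegral_comp_smul_annulus {g : E → ENNReal} (hg : Measurable g) {r : ℝ} (hr : 0 < r)
    {I J : Set ℝ} (hI : MeasurableSet I) (hIJ : ∀ s, r * s ∈ J ↔ s ∈ I) :
    ∫⁻ x in norm ⁻¹' I, g (r • x) ∂μ =
      ENNReal.ofReal |(r ^ Module.finrank ℝ E)⁻¹| * ∫⁻ x in norm ⁻¹' J, g x ∂μ := by
  have hJ : MeasurableSet J := by
    have : J = (fun s => r⁻¹ * s) ⁻¹' I := by
      ext s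
      rw [mem_preimage, ← hIJ, mul_inv_cancel_left₀ hr.ne']
    rw [this]
    exact hI.preimage (by fun_prop)
  have h := lintegral_comp_add_smul μ (hg.indicator (measurable_norm hJ)) 0 hr.ne'
  rw [← lintegral_indicator (measurable_norm hI), ← lintegral_indicator (measurable_norm hJ), ← h]
  refine lintegral_congr fun x => ?_
  have : (0 : E) + r • x ∈ norm ⁻¹' J ↔ x ∈ norm ⁻¹' I := by
    simp [norm_smul, abs_of_pos hr, hIJ]
  by_cases hx : x ∈ norm ⁻¹' I
  · rw [indicator_of_mem hx, indicator_of_mem (this.2 hx), zero_add]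
  · rw [indicator_of_notMem hx, indicator_of_notMem (mt this.1 hx)]

variable (μ) in
/-- Poincaré inequality on the annuli `{r < ‖x‖ < 2r}`, with a constant independent of `r`. -/
lemma exists_poincare_annulus (hE : 1 < Module.rank ℝ E) {q : ℝ} (hq : 1 ≤ q) :
    ∃ C : ℝ≥0∞, C ≠ ⊤ ∧ ∀ r : ℝ, 0 < r → ∀ u : E → ℝ, ContDiff ℝ 1 u → ∃ c : ℝ,
      ∫⁻ x in norm ⁻¹' Icc (7 / 5 * r) (8 / 5 * r), ‖u x - c‖ₑ ^ q ∂μ ≤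
        C * (ENNReal.ofReal r ^ q * ∫⁻ x in norm ⁻¹' Ioo r (2 * r), ‖fderiv ℝ u x‖ₑ ^ q ∂μ) := by
  obtain ⟨V, hV0, hV, C, hC, h⟩ := oscillationControlled_annulus (μ := μ) hE hq
  have hq0 : 0 ≤ q := by linarith
  refine ⟨C / μ V, by finiteness, fun r hr u hu => ?_⟩
  have hucont := hu.continuous
  have hdcont := hu.continuous_fderiv one_ne_zero
  set v : E → ℝ := fun x => u (r • x)
  have hv : ContDiff ℝ 1 v := hu.comp (contDiff_const_smul r)
  have hvc := hv.continuous
  have hdv (x : E) : fderiv ℝ v x = r • fderiv ℝ u (r • x) := fderiv_comp_smul r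
  obtain ⟨z, -, hz⟩ := exists_le_setLAverage (μ := μ) (s := V)
    (f := fun z => ∫⁻ x in {x | 7 / 5 ≤ ‖x‖ ∧ ‖x‖ ≤ 8 / 5}, ‖v x - v z‖ₑ ^ q ∂μ) hV0 hV
    (Measurable.lintegral_prod_right' (f := fun w : E × E => ‖v w.2 - v w.1‖ₑ ^ q)
      (by fun_prop)).aemeasurable
  have hk0 : ENNReal.ofReal |(r ^ Module.finrank ℝ E)⁻¹| ≠ 0 := by
    simp only [ne_eq, ENNReal.ofReal_eq_zero, not_le]
    positivity
  refine ⟨v z, (ENNReal.mul_le_mul_iff_right hk0 ENNReal.ofReal_ne_top).1 ?_⟩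
  calc ENNReal.ofReal |(r ^ Module.finrank ℝ E)⁻¹| *
        ∫⁻ x in norm ⁻¹' Icc (7 / 5 * r) (8 / 5 * r), ‖u x - v z‖ₑ ^ q ∂μ
      = ∫⁻ x in norm ⁻¹' Icc (7 / 5) (8 / 5), ‖v x - v z‖ₑ ^ q ∂μ := by
        refine (setLIntegral_comp_smul_annulus μ (g := fun x => ‖u x - v z‖ₑ ^ q) (by fun_prop) hr
          measurableSet_Icc fun s => ?_).symm
        rw [mem_Icc, mem_Icc, mul_comm r, mul_le_mul_iff_left₀ hr, mul_le_mul_iff_left₀ hr]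
    _ ≤ (∫⁻ z in V, ∫⁻ x in {x | 7 / 5 ≤ ‖x‖ ∧ ‖x‖ ≤ 8 / 5}, ‖v x - v z‖ₑ ^ q ∂μ ∂μ) / μ V := by
        rw [← setLAverage_eq]
        exact hz
    _ ≤ (C * ∫⁻ x in norm ⁻¹' Ioo 1 2, ‖fderiv ℝ v x‖ₑ ^ q ∂μ) / μ V := by
        rw [lintegral_lintegral_swap (by fun_prop)]
        gcongr
        exact h v hv
    _ = (C * (ENNReal.ofReal r ^ q *
          ∫⁻ x in norm ⁻¹' Ioo 1 2, ‖fderiv ℝ u (r • x)‖ₑ ^ q ∂μ)) / μ V := by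
        simp_rw [hdv, enorm_smul, ENNReal.mul_rpow_of_nonneg _ _ hq0,
          Real.enorm_eq_ofReal hr.le]
        rw [lintegral_const_mul _ (by fun_prop)]
    _ = _ := by
        rw [setLIntegral_comp_smul_annulus μ (g := fun x => ‖fderiv ℝ u x‖ₑ ^ q)
          (J := Ioo r (2 * r)) (by fun_prop) hr measurableSet_Ioo fun s => ?_]
        · simp only [div_eq_mul_inv]
          ring
        · rw [mem_Ioo, mem_Ioo, mul_comm 2, mul_lt_mul_iff_right₀ hr, lt_mul_iff_one_lt_right hr]

end Poincare

section TestFunctions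

variable {E : Type*} [NormedAddCommGroup E] [NormedSpace ℝ E] [MeasurableSpace E] [BorelSpace E]
  [FiniteDimensional ℝ E] {μ : Measure E}

lemma MeasureTheory.LocallyIntegrable.integrable_clm_apply {F : E → E}
    (hF : LocallyIntegrable F μ) {L : E → E →L[ℝ] ℝ} (hL : Continuous L)
    (hLc : HasCompactSupport L) : Integrable (fun x => L x (F x)) μ := by
  have hFn : LocallyIntegrable (fun x => ‖F x‖) μ := fun x => (hF x).norm
  refine (hFn.integrable_smul_left_of_hasCompactSupport hL.norm hLc.norm).mono'
    ?_ (Filter.Eventually.of_forall fun x => (L x).le_opNorm (F x))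
  exact (ContinuousLinearMap.id ℝ (E →L[ℝ] ℝ)).aestronglyMeasurable_comp₂
    hL.aestronglyMeasurable hF.aestronglyMeasurable

/-- A locally integrable vector field that annihilates the differentials of smooth compactly
supported functions also annihilates those of `C¹` compactly supported functions. -/
lemma integral_fderiv_apply_eq_zero_of_smooth [μ.IsAddHaarMeasure] {F : E → E}
    (hF : LocallyIntegrable F μ)
    (hsmooth : ∀ φ : E → ℝ, ContDiff ℝ ∞ φ → HasCompactSupport φ →
      ∫ x, fderiv ℝ φ x (F x) ∂μ = 0)
    {φ : E → ℝ} (hφ : ContDiff ℝ 1 φ) (hφc : HasCompactSupport φ) :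
    ∫ x, fderiv ℝ φ x (F x) ∂μ = 0 := by
  have hd := hφ.continuous_fderiv one_ne_zero
  have hdc : HasCompactSupport (fderiv ℝ φ) := hφc.fderiv ℝ
  set K := cthickening 1 (tsupport (fderiv ℝ φ))
  have hK : IsCompact K := hdc.isCompact.cthickening
  have hFK : IntegrableOn F K μ := hF.integrableOn_isCompact hK
  set M := ∫ x in K, ‖F x‖ ∂μ
  have hM : 0 ≤ M := integral_nonneg fun x => norm_nonneg _
  suffices h : ∀ ε > 0, ‖∫ x, fderiv ℝ φ x (F x) ∂μ‖ ≤ ε * M by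
    refine norm_le_zero_iff.1 (le_of_forall_pos_le_add fun ε hε => ?_)
    refine (h (ε / (M + 1)) (by positivity)).trans ?_
    rw [zero_add, div_mul_eq_mul_div, div_le_iff₀ (by positivity)]
    nlinarith
  intro ε hε
  obtain ⟨δ, hδ, hunif⟩ := Metric.uniformContinuous_iff.1
    (hdc.uniformContinuous_of_continuous hd) ε hε
  have hδ' : 0 < min δ 1 := lt_min hδ one_pos
  let β : ContDiffBump (0 : E) := ⟨min δ 1 / 2, min δ 1, by positivity, by linarith⟩
  let ψ : E → ℝ := convolution (β.normed μ) φ (ContinuousLinearMap.lsmul ℝ ℝ) μ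
  have hψ : ContDiff ℝ ∞ ψ := β.hasCompactSupport_normed.contDiff_convolution_left _
    β.contDiff_normed hφ.continuous.locallyIntegrable
  have hψc : HasCompactSupport ψ := β.hasCompactSupport_normed.convolution _ hφc
  have hdψ (x : E) : fderiv ℝ ψ x =
      convolution (β.normed μ) (fderiv ℝ φ) (ContinuousLinearMap.lsmul ℝ ℝ) μ x := by
    rw [(hφc.hasFDerivAt_convolution_right (ContinuousLinearMap.lsmul ℝ ℝ)
      β.continuous_normed.locallyIntegrable hφ x).fderiv]
    rfl
  have hclose (x : E) : ‖fderiv ℝ φ x - fderiv ℝ ψ x‖ ≤ K.indicator (fun _ => ε) x := by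
    rw [← dist_eq_norm, dist_comm, hdψ]
    refine β.dist_normed_convolution_le hd.aestronglyMeasurable fun y hy => ?_
    have hy' : dist y x < min δ 1 := hy
    by_cases hx : x ∈ K
    · rw [Set.indicator_of_mem hx]
      exact (hunif (hy'.trans_le (min_le_left _ _))).le
    · have hzero (z : E) (hz : dist z x < 1) : fderiv ℝ φ z = 0 := by
        by_contra h
        exact hx (mem_cthickening_of_dist_le x z 1 _ (subset_tsupport _ h)
          (by rw [dist_comm]; exact hz.le))
      rw [Set.indicator_of_notMem hx, hzero y (hy'.trans_le (min_le_right _ _)),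
        hzero x (by simp), dist_self]
  have hint := hF.integrable_clm_apply hd hdc
  have hintψ := hF.integrable_clm_apply (hψ.continuous_fderiv (by simp)) (hψc.fderiv ℝ)
  have hsub : ∫ x, fderiv ℝ φ x (F x) ∂μ = ∫ x, (fderiv ℝ φ x - fderiv ℝ ψ x) (F x) ∂μ := by
    simp only [sub_apply]
    rw [integral_sub hint hintψ, hsmooth ψ hψ hψc, sub_zero]
  calc ‖∫ x, fderiv ℝ φ x (F x) ∂μ‖
      ≤ ∫ x, K.indicator (fun x => ε * ‖F x‖) x ∂μ := by
        rw [hsub]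
        refine norm_integral_le_of_norm_le
          ((integrable_indicator_iff hK.measurableSet).2 (hFK.norm.const_mul ε))
          (Filter.Eventually.of_forall fun x => ?_)
        refine ((fderiv ℝ φ x - fderiv ℝ ψ x).le_opNorm (F x)).trans ?_
        refine (mul_le_mul_of_nonneg_right (hclose x) (norm_nonneg _)).trans_eq ?_
        by_cases hx : x ∈ K <;> simp [hx]
    _ = ε * M := by rw [integral_indicator hK.measurableSet, integral_const_mul]

lemma integral_cutoff_smul_fderiv [μ.IsAddHaarMeasure] {F : E → E} (hF : LocallyIntegrable F μ)
    (hsmooth : ∀ φ : E → ℝ, ContDiff ℝ ∞ φ → HasCompactSupport φ →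
      ∫ x, fderiv ℝ φ x (F x) ∂μ = 0)
    {u η : E → ℝ} (hu : ContDiff ℝ 1 u) (hη : ContDiff ℝ 1 η) (hηc : HasCompactSupport η) (c : ℝ) :
    ∫ x, (η x • fderiv ℝ u x) (F x) ∂μ = -∫ x, ((u x - c) • fderiv ℝ η x) (F x) ∂μ := by
  have hint1 : Integrable (fun x => (η x • fderiv ℝ u x) (F x)) μ :=
    hF.integrable_clm_apply (hη.continuous.smul (hu.continuous_fderiv one_ne_zero)) hηc.smul_right
  have hdc : HasCompactSupport fun x => (u x - c) • fderiv ℝ η x :=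
    (hηc.fderiv ℝ).mono fun x hx h => hx (by simp [h])
  have hint2 : Integrable (fun x => ((u x - c) • fderiv ℝ η x) (F x)) μ :=
    hF.integrable_clm_apply ((hu.continuous.sub continuous_const).smul
      (hη.continuous_fderiv one_ne_zero)) hdc
  have hφ : ContDiff ℝ 1 fun x => (u x - c) * η x := (hu.sub contDiff_const).mul hη
  have hφc : HasCompactSupport fun x => (u x - c) * η x := hηc.mul_left
  have h := integral_fderiv_apply_eq_zero_of_smooth hF hsmooth hφ hφc
  rw [eq_neg_iff_add_eq_zero, ← integral_add hint1 hint2, ← h]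
  refine integral_congr_ae (Filter.Eventually.of_forall fun x => ?_)
  have hd := ((hu.differentiable one_ne_zero x).sub_const c).hasFDerivAt.fun_mul
    (hη.differentiable one_ne_zero x).hasFDerivAt
  rw [fderiv_sub_const] at hd
  beta_reduce
  rw [hd.fderiv, add_apply, add_comm]

/-- Smooth cutoffs between the balls of radius `7r/5` and `8r/5`, with gradient of order `1/r`. -/
lemma exists_cutoff (E : Type*) [NormedAddCommGroup E] [NormedSpace ℝ E] [FiniteDimensional ℝ E] :
    ∃ M : ℝ, 0 ≤ M ∧ ∀ r : ℝ, 0 < r → ∃ η : E → ℝ, ContDiff ℝ ∞ η ∧ HasCompactSupport η ∧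
      (∀ x, 0 ≤ η x) ∧ (∀ x, ‖x‖ < r → η x = 1) ∧ (∀ x, ‖fderiv ℝ η x‖ ≤ M / r) ∧
      ∀ x, ‖x‖ ∉ Set.Icc (7 / 5 * r) (8 / 5 * r) → fderiv ℝ η x = 0 := by
  let β : ContDiffBump (0 : E) := ⟨7 / 5, 8 / 5, by norm_num, by norm_num⟩
  have hβ : ContDiff ℝ ∞ (β : E → ℝ) := β.contDiff
  obtain ⟨M, hM⟩ := (β.hasCompactSupport.fderiv ℝ).exists_bound_of_continuous
    (hβ.continuous_fderiv (by simp))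
  have hM0 : 0 ≤ M := (norm_nonneg _).trans (hM 0)
  refine ⟨M, hM0, fun r hr => ⟨fun x => β (r⁻¹ • x), hβ.comp (contDiff_const_smul _),
    β.hasCompactSupport.comp_smul (inv_ne_zero hr.ne'), fun x => β.nonneg, fun x hx => ?_,
    fun x => ?_, fun x hx => ?_⟩⟩
  · refine β.one_of_mem_closedBall ?_
    rw [mem_closedBall_zero_iff, norm_smul, norm_inv, Real.norm_of_nonneg hr.le,
      inv_mul_le_iff₀ hr]
    change ‖x‖ ≤ r * (7 / 5)
    linarith
  · rw [fderiv_comp_smul, norm_smul, norm_inv, Real.norm_of_nonneg hr.le, div_eq_inv_mul]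
    gcongr
    exact hM _
  · rw [fderiv_comp_smul]
    have hnorm : ‖r⁻¹ • x‖ = r⁻¹ * ‖x‖ := by
      rw [norm_smul, norm_inv, Real.norm_of_nonneg hr.le]
    have : fderiv ℝ β (r⁻¹ • x) = 0 := by
      rw [Set.mem_Icc, not_and_or, not_le, not_le] at hx
      rcases hx with hx | hx
      · refine (β.eventuallyEq_one_of_mem_ball ?_).fderiv_eq.trans (by simp)
        rw [mem_ball_zero_iff, hnorm, inv_mul_lt_iff₀ hr]
        change ‖x‖ < r * (7 / 5)
        linarith
      · refine image_eq_zero_of_notMem_tsupport fun h => ?_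
        have := tsupport_fderiv_subset ℝ h
        rw [β.tsupport_eq, mem_closedBall_zero_iff, hnorm, inv_mul_le_iff₀ hr] at this
        change ‖x‖ ≤ r * (8 / 5) at this
        linarith
    rw [this, smul_zero]

end TestFunctions

lemma mul_rpow_sub_one_le_add {a b q : ℝ} (ha : 0 ≤ a) (hb : 0 ≤ b) (hq : 1 ≤ q) :
    a * b ^ (q - 1) ≤ a ^ q + b ^ q := by
  have hpow (x : ℝ) (hx : 0 ≤ x) : x * x ^ (q - 1) = x ^ q := by
    rw [mul_comm, ← Real.rpow_add_one' hx (by linarith), sub_add_cancel]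
  rcases le_total a b with h | h
  · calc a * b ^ (q - 1) ≤ b * b ^ (q - 1) := by gcongr
      _ = b ^ q := hpow b hb
      _ ≤ _ := le_add_of_nonneg_left (by positivity)
  · calc a * b ^ (q - 1) ≤ a * a ^ (q - 1) := by
          gcongr
      _ = a ^ q := hpow a ha
      _ ≤ _ := le_add_of_nonneg_right (by positivity)

section Growth

variable {n : ℕ} {p : Euc n → ℝ} {pm pP : ℝ} {𝒜 : Euc n → ℝ → Euc n → Euc n} {am bP : ℝ}
  {u : Euc n → ℝ}

lemma norm_gradient_eq_norm_fderiv (u : Euc n → ℝ) (x : Euc n) :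
    ‖gradient u x‖ = ‖fderiv ℝ u x‖ := by
  simp [gradient]

lemma inner_gradient_eq_fderiv (u : Euc n → ℝ) (x v : Euc n) :
    (inner ℝ v (gradient u x) : ℝ) = fderiv ℝ u x v := by
  rw [real_inner_comm, gradient, InnerProductSpace.toDual_symm_apply]

lemma IsNSGrowth.bP_nonneg (h𝒜 : IsNSGrowth p 𝒜 am bP) : 0 ≤ bP := by
  obtain ⟨a, b, -, -, hab, -, -⟩ := h𝒜.growth
  linarith [hab 0, h𝒜.am_pos]

lemma IsNSGrowth.norm_le (h𝒜 : IsNSGrowth p 𝒜 am bP) (x : Euc n) (t : ℝ) (ξ : Euc n) :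
    ‖𝒜 x t ξ‖ ≤ bP * ‖ξ‖ ^ (p x - 1) := by
  obtain ⟨a, b, -, -, hab, -, h⟩ := h𝒜.growth
  refine (h x t ξ).trans ?_
  gcongr
  exact (hab x).2.2

lemma IsNSGrowth.le_inner (h𝒜 : IsNSGrowth p 𝒜 am bP) (x : Euc n) (t : ℝ) (ξ : Euc n) :
    am * ‖ξ‖ ^ p x ≤ (inner ℝ (𝒜 x t ξ) ξ : ℝ) := by
  obtain ⟨a, b, -, -, hab, h, -⟩ := h𝒜.growth
  refine le_trans ?_ (h x t ξ)
  gcongr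
  exact (hab x).1

lemma continuous_gradient_of_contDiff (hu : ContDiff ℝ 1 u) : Continuous (gradient u) :=
  (InnerProductSpace.toDual ℝ (Euc n)).symm.continuous.comp (hu.continuous_fderiv one_ne_zero)

lemma IsNSGrowth.locallyIntegrable_comp (h𝒜 : IsNSGrowth p 𝒜 am bP) (hp : IsVarExp p pm pP)
    (hu : ContDiff ℝ 1 u) :
    LocallyIntegrable (fun x => 𝒜 x (u x) (gradient u x)) (volume : Measure (Euc n)) := by
  have hgrad := continuous_gradient_of_contDiff hu
  have hmeas : Measurable fun x => 𝒜 x (u x) (gradient u x) :=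
    (measurable_uncurry_of_continuous_of_measurable
      (u := fun (tξ : ℝ × Euc n) x => 𝒜 x tξ.1 tξ.2) h𝒜.cont fun tξ => h𝒜.meas tξ.1 tξ.2).comp
      ((hu.continuous.measurable.prodMk hgrad.measurable).prodMk measurable_id)
  have hbound : Continuous fun x => bP * (1 + ‖gradient u x‖) ^ (pP - 1) := by
    refine continuous_const.mul ((continuous_const.add hgrad.norm).rpow_const fun x => Or.inl ?_)
    exact (add_pos_of_pos_of_nonneg one_pos (norm_nonneg _)).ne'
  refine hbound.locallyIntegrable.mono hmeas.aestronglyMeasurable ?_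
  filter_upwards [hp.ae_lb, hp.ae_ub] with x h1 h2
  have hb := h𝒜.bP_nonneg
  refine ((h𝒜.norm_le x _ _).trans ?_).trans (le_abs_self _)
  have := hp.one_lt
  gcongr
  calc ‖gradient u x‖ ^ (p x - 1) ≤ (1 + ‖gradient u x‖) ^ (p x - 1) :=
        Real.rpow_le_rpow (norm_nonneg _) (by linarith) (by linarith)
    _ ≤ _ := Real.rpow_le_rpow_of_exponent_le (by linarith [norm_nonneg (gradient u x)])
        (by linarith)

/-- Caccioppoli-type estimate: the energy in `B_r` is bounded by the energy outside `B_r`. -/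
lemma IsAHarmonic.exists_energy_bound (hn : 2 ≤ n) (hp : IsVarExp p pm pP)
    (h𝒜 : IsNSGrowth p 𝒜 am bP) {q : ℝ} (hq : 1 ≤ q) (hu : IsAHarmonic p 𝒜 u) :
    ∃ C : ENNReal, C ≠ ⊤ ∧ ∀ r : ℝ, 0 < r →
      (∀ᵐ x ∂(volume.restrict (ball (0 : Euc n) (2 * r) \ ball 0 r)), p x = q) →
      ENNReal.ofReal am * ∫⁻ x in ball (0 : Euc n) r, ENNReal.ofReal (‖gradient u x‖ ^ p x) ≤
        C * ∫⁻ x in (ball (0 : Euc n) r)ᶜ, ENNReal.ofReal (‖gradient u x‖ ^ p x) := by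
  obtain ⟨huC, -, hweak⟩ := hu
  have hrank : 1 < Module.rank ℝ (Euc n) := by
    rw [← Module.finrank_eq_rank, finrank_euclideanSpace_fin]
    exact_mod_cast hn
  obtain ⟨C, hC, hpoincare⟩ := exists_poincare_annulus (volume : Measure (Euc n)) hrank hq
  obtain ⟨M, hM, hcutoff⟩ := exists_cutoff (Euc n)
  have hb := h𝒜.bP_nonneg
  have ham := h𝒜.am_pos
  have hq0 : 0 ≤ q := by linarith
  refine ⟨ENNReal.ofReal (M * bP) * (C + 1), by finiteness, fun r hr hpq => ?_⟩
  obtain ⟨c, hc⟩ := hpoincare r hr u huC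
  obtain ⟨η, hη, hηc, hη0, hη1, hdη, hdη0⟩ := hcutoff r hr
  set F : Euc n → Euc n := fun x => 𝒜 x (u x) (gradient u x)
  have hF : LocallyIntegrable F volume := h𝒜.locallyIntegrable_comp hp huC
  have hη' : ContDiff ℝ 1 η := hη.of_le (by simp)
  have hdu := huC.continuous_fderiv one_ne_zero
  have hdu_apply (x : Euc n) : am * ‖gradient u x‖ ^ p x ≤ fderiv ℝ u x (F x) := by
    rw [← inner_gradient_eq_fderiv]
    exact h𝒜.le_inner x _ _
  set A : Set (Euc n) := norm ⁻¹' Set.Ioo r (2 * r)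
  set K : Set (Euc n) := norm ⁻¹' Set.Icc (7 / 5 * r) (8 / 5 * r)
  have hAm : MeasurableSet A := measurable_norm measurableSet_Ioo
  have hKm : MeasurableSet K := measurable_norm measurableSet_Icc
  have hAsub : A ⊆ ball (0 : Euc n) (2 * r) \ ball 0 r := by
    rintro x ⟨h1, h2⟩
    simp only [Set.mem_sdiff, mem_ball_zero_iff, not_lt]
    exact ⟨h2, h1.le⟩
  have hKA : K ⊆ A := by
    rintro x ⟨h1, h2⟩
    constructor <;> linarith
  have hpqA : ∀ᵐ x, x ∈ A → p x = q :=
    (ae_restrict_iff' hAm).1 (ae_restrict_of_ae_restrict_of_subset hAsub hpq)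
  have hweakF (φ : Euc n → ℝ) (h1 : ContDiff ℝ ∞ φ) (h2 : HasCompactSupport φ) :
      ∫ x, fderiv ℝ φ x (F x) = 0 := by
    simpa only [inner_gradient_eq_fderiv] using hweak φ h1 h2
  have hint1 : Integrable fun x => (η x • fderiv ℝ u x) (F x) :=
    hF.integrable_clm_apply (hη.continuous.smul hdu) hηc.smul_right
  have htest := integral_cutoff_smul_fderiv hF hweakF huC hη' hηc c
  calc ENNReal.ofReal am * ∫⁻ x in ball (0 : Euc n) r, ENNReal.ofReal (‖gradient u x‖ ^ p x)
      = ∫⁻ x in ball (0 : Euc n) r, ENNReal.ofReal (am * ‖gradient u x‖ ^ p x) := by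
        rw [← lintegral_const_mul' _ _ ENNReal.ofReal_ne_top]
        simp only [ENNReal.ofReal_mul ham.le]
    _ ≤ ∫⁻ x in ball (0 : Euc n) r, ENNReal.ofReal ((η x • fderiv ℝ u x) (F x)) := by
        refine setLIntegral_mono' measurableSet_ball fun x hx => ENNReal.ofReal_le_ofReal ?_
        simpa [hη1 x (mem_ball_zero_iff.1 hx)] using hdu_apply x
    _ ≤ ∫⁻ x, ENNReal.ofReal ((η x • fderiv ℝ u x) (F x)) := setLIntegral_le_lintegral _ _
    _ = ENNReal.ofReal (∫ x, (η x • fderiv ℝ u x) (F x)) := by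
        refine (ofReal_integral_eq_lintegral_ofReal hint1
          (Filter.Eventually.of_forall fun x => mul_nonneg (hη0 x) ?_)).symm
        exact le_trans (by positivity) (hdu_apply x)
    _ ≤ ‖∫ x, ((u x - c) • fderiv ℝ η x) (F x)‖ₑ := by
        rw [htest, ← ofReal_norm, ← norm_neg]
        exact ENNReal.ofReal_le_ofReal (le_abs_self _)
    _ ≤ ∫⁻ x, ‖((u x - c) • fderiv ℝ η x) (F x)‖ₑ := enorm_integral_le_lintegral_enorm _
    _ ≤ ∫⁻ x in K, ENNReal.ofReal (M * bP) *
          ((ENNReal.ofReal r ^ q)⁻¹ * ‖u x - c‖ₑ ^ q + ‖fderiv ℝ u x‖ₑ ^ q) := by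
        rw [← lintegral_indicator hKm]
        refine lintegral_mono_ae ?_
        filter_upwards [hpqA] with x hx
        by_cases hxK : x ∈ K
        swap
        · simp [hdη0 x hxK]
        rw [Set.indicator_of_mem hxK]
        have hFx : ‖F x‖ ≤ bP * ‖fderiv ℝ u x‖ ^ (q - 1) := by
          rw [← hx (hKA hxK), ← norm_gradient_eq_norm_fderiv]
          exact h𝒜.norm_le x _ _
        have hreal : ‖((u x - c) • fderiv ℝ η x) (F x)‖ ≤
            M * bP * ((‖u x - c‖ / r) ^ q + ‖fderiv ℝ u x‖ ^ q) := by
          calc ‖((u x - c) • fderiv ℝ η x) (F x)‖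
              ≤ ‖u x - c‖ * (M / r * (bP * ‖fderiv ℝ u x‖ ^ (q - 1))) := by
                rw [smul_apply, norm_smul]
                gcongr
                refine ((fderiv ℝ η x).le_opNorm _).trans ?_
                gcongr
                exact hdη x
            _ = M * bP * (‖u x - c‖ / r * ‖fderiv ℝ u x‖ ^ (q - 1)) := by ring
            _ ≤ _ := by
                gcongr
                exact mul_rpow_sub_one_le_add (by positivity) (norm_nonneg _) hq
        rw [← ofReal_norm]
        refine (ENNReal.ofReal_le_ofReal hreal).trans_eq ?_
        rw [ENNReal.ofReal_mul (by positivity), ENNReal.ofReal_add (by positivity) (by positivity),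
          ← ENNReal.ofReal_rpow_of_nonneg (by positivity) hq0,
          ← ENNReal.ofReal_rpow_of_nonneg (by positivity) hq0, ENNReal.ofReal_div_of_pos hr,
          ofReal_norm, ofReal_norm, ENNReal.div_rpow_of_nonneg _ _ hq0, ENNReal.div_eq_inv_mul]
    _ = ENNReal.ofReal (M * bP) * ((ENNReal.ofReal r ^ q)⁻¹ * (∫⁻ x in K, ‖u x - c‖ₑ ^ q) +
          ∫⁻ x in K, ‖fderiv ℝ u x‖ₑ ^ q) := by
        have := huC.continuous
        rw [lintegral_const_mul _ (by fun_prop), lintegral_add_left (by fun_prop),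
          lintegral_const_mul _ (by fun_prop)]
    _ ≤ ENNReal.ofReal (M * bP) * ((ENNReal.ofReal r ^ q)⁻¹ *
          (C * (ENNReal.ofReal r ^ q * ∫⁻ x in A, ‖fderiv ℝ u x‖ₑ ^ q)) +
          ∫⁻ x in A, ‖fderiv ℝ u x‖ₑ ^ q) := by gcongr
    _ = ENNReal.ofReal (M * bP) * (C + 1) * ∫⁻ x in A, ‖fderiv ℝ u x‖ₑ ^ q := by
        have hr0 : ENNReal.ofReal r ^ q ≠ 0 := by
          simp [ENNReal.rpow_eq_zero_iff, hr, not_le]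
        have hrtop : ENNReal.ofReal r ^ q ≠ ⊤ := by finiteness
        rw [mul_left_comm C, ENNReal.inv_mul_cancel_left hr0 hrtop]
        ring
    _ = ENNReal.ofReal (M * bP) * (C + 1) *
          ∫⁻ x in A, ENNReal.ofReal (‖gradient u x‖ ^ p x) := by
        congr 1
        refine setLIntegral_congr_fun_ae hAm ?_
        filter_upwards [hpqA] with x hx hxA
        rw [hx hxA, norm_gradient_eq_norm_fderiv,
          ← ENNReal.ofReal_rpow_of_nonneg (norm_nonneg _) hq0, ofReal_norm]
    _ ≤ _ := by
        gcongr
        exact hAsub.trans fun x hx => hx.2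

end Growth

/-- Theorem 3.4: let `n ≥ 2` and suppose `p ≡ q` a.e. on annuli `B_{2R_k}∖B_{R_k}`
with `R_k → ∞`, where `1 ≤ q ≤ p⁺` is constant. Then every `𝒜`-harmonic function
with `∫_{ℝⁿ} |∇u|^{p(x)} < ∞` is constant. -/
theorem liouville_finite_energy {n : ℕ} (hn : 2 ≤ n) (p : Euc n → ℝ) (pm pP : ℝ)
    (hp : IsVarExp p pm pP)
    (𝒜 : Euc n → ℝ → Euc n → Euc n) (am bP : ℝ)
    (h𝒜 : IsNSGrowth p 𝒜 am bP)
    (R : ℕ → ℝ) (hRmono : StrictMono R)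
    (hRtop : Filter.Tendsto R Filter.atTop Filter.atTop)
    (q : ℝ) (hq1 : 1 ≤ q) (hqP : q ≤ pP)
    (hann : ∀ k, ∀ᵐ x ∂(volume.restrict
      (Metric.ball (0 : Euc n) (2 * R k) \ Metric.ball 0 (R k))), p x = q)
    (u : Euc n → ℝ) (hu : IsAHarmonic p 𝒜 u)
    (hint : Integrable (fun x => ‖gradient u x‖ ^ p x) (volume : Measure (Euc n))) :
    ∃ c : ℝ, ∀ x, u x = c := by
  set G : Euc n → ENNReal := fun x => ENNReal.ofReal (‖gradient u x‖ ^ p x)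
  have hpos (x : Euc n) : 0 ≤ ‖gradient u x‖ ^ p x := by positivity
  obtain ⟨C, hC, hbound⟩ := hu.exists_energy_bound hn hp h𝒜 hq1
  set ν := volume.withDensity G
  have : IsFiniteMeasure ν := isFiniteMeasure_withDensity_ofReal hint.2
  have hν {s : Set (Euc n)} (hs : MeasurableSet s) : ν s = ∫⁻ x in s, G x :=
    withDensity_apply _ hs
  have hballs : Filter.Tendsto (fun k => ν (ball 0 (R k))) Filter.atTop (nhds (ν Set.univ)) := by
    have hUnion : ⋃ k, ball (0 : Euc n) (R k) = Set.univ :=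
      Set.eq_univ_of_forall fun x => Set.mem_iUnion.2
        ((hRtop.eventually_gt_atTop ‖x‖).exists.imp fun k hk => mem_ball_zero_iff.2 hk)
    rw [← hUnion]
    exact tendsto_measure_iUnion_atTop fun i j hij => ball_subset_ball (hRmono.monotone hij)
  have hcompl : Filter.Tendsto (fun k => ν (ball 0 (R k))ᶜ) Filter.atTop (nhds 0) := by
    have h := ENNReal.Tendsto.sub (tendsto_const_nhds (x := ν Set.univ)) hballs
      (Or.inl (measure_ne_top ν _))
    rw [tsub_self] at h
    simpa only [measure_compl measurableSet_ball (measure_ne_top ν _)] using h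
  have hle : ENNReal.ofReal am * ν Set.univ ≤ C * 0 := by
    refine le_of_tendsto_of_tendsto
      (ENNReal.Tendsto.const_mul hballs (Or.inr ENNReal.ofReal_ne_top))
      (ENNReal.Tendsto.const_mul hcompl (Or.inr hC)) ?_
    filter_upwards [hRtop.eventually_gt_atTop 0] with k hk
    rw [hν measurableSet_ball, hν measurableSet_ball.compl]
    exact hbound (R k) hk (hann k)
  have hzero : ν Set.univ = 0 := by
    simpa [h𝒜.am_pos.not_ge] using hle
  have hG : G =ᵐ[volume] 0 := by
    rw [hν MeasurableSet.univ, setLIntegral_univ,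
      lintegral_eq_zero_iff' hint.1.aemeasurable.ennreal_ofReal] at hzero
    exact hzero
  have hgrad : gradient u = 0 := by
    refine (Continuous.ae_eq_iff_eq volume (continuous_gradient_of_contDiff hu.1)
      continuous_zero).1 ?_
    filter_upwards [hG] with x hx
    have h0 : ‖gradient u x‖ ^ p x = 0 :=
      le_antisymm (ENNReal.ofReal_eq_zero.1 hx) (hpos x)
    simpa using (Real.rpow_eq_zero_iff_of_nonneg (norm_nonneg _)).1 h0 |>.1
  refine ⟨u 0, fun x => is_const_of_fderiv_eq_zero (hu.1.differentiable one_ne_zero)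
    (fun y => ?_) x 0⟩
  rw [← norm_eq_zero, ← norm_gradient_eq_norm_fderiv, hgrad]
  simp

end
end

section
/- Let n ≥ 2 and let 𝒜 be of nonstandard p(·)-growth with constants a₋, b⁺. Suppose there exist an increasing sequence of radii R_k → ∞ and a constant q with n ≤ q ≤ p⁺ such that p(x) = q for almost every x in the annulus B_{2R_k}∖B_{R_k}, for every k. If u is a bounded 𝒜-harmonic function in ℝⁿ, then u is constant. -/
open MeasureTheory Metric Real
open scoped ContDiff

noncomputable section

theorem integrable_fderiv_apply {n : ℕ} {V : Euc n → Euc n} (hV : LocallyIntegrable V volume)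
    {φ : Euc n → ℝ} (hφ : ContDiff ℝ 1 φ) (hφc : HasCompactSupport φ) :
    Integrable fun x => fderiv ℝ φ x (V x) := by
  have hcont : Continuous (fderiv ℝ φ) := hφ.continuous_fderiv one_ne_zero
  have hn : LocallyIntegrable (fun x => ‖V x‖) volume :=
    hV.mono hV.aestronglyMeasurable.norm (ae_of_all _ fun x => (norm_norm _).le)
  have hdom := hn.integrable_smul_left_of_hasCompactSupport hcont.norm (hφc.fderiv ℝ).norm
  refine hdom.mono' ?_ (ae_of_all _ fun x => ContinuousLinearMap.le_opNorm _ _)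
  exact (ContinuousLinearMap.apply ℝ ℝ).flip.aestronglyMeasurable_comp₂
    hcont.aestronglyMeasurable hV.aestronglyMeasurable

/-- A locally integrable vector field that is weakly divergence free against smooth compactly
supported functions is so against `C¹` compactly supported functions. -/
theorem integral_fderiv_apply_eq_zero_of_contDiff_one {n : ℕ} {V : Euc n → Euc n}
    (hV : LocallyIntegrable V volume)
    (h : ∀ φ : Euc n → ℝ, ContDiff ℝ ∞ φ → HasCompactSupport φ → ∫ x, fderiv ℝ φ x (V x) = 0)
    {φ : Euc n → ℝ} (hφ : ContDiff ℝ 1 φ) (hφc : HasCompactSupport φ) :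
    ∫ x, fderiv ℝ φ x (V x) = 0 := by
  set K : Set (Euc n) := cthickening 1 (tsupport φ)
  have hKc : IsCompact K := IsCompact.cthickening hφc
  have hVK : IntegrableOn V K := hV.integrableOn_isCompact hKc
  have hcont : Continuous (fderiv ℝ φ) := hφ.continuous_fderiv one_ne_zero
  have hdc : HasCompactSupport (fderiv ℝ φ) := hφc.fderiv ℝ
  have huc : UniformContinuous (fderiv ℝ φ) := hdc.uniformContinuous_of_continuous hcont
  have key : ∀ ε > 0, |∫ x, fderiv ℝ φ x (V x)| ≤ ε * ∫ x in K, ‖V x‖ := by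
    intro ε hε
    obtain ⟨δ, hδ, hδ'⟩ := Metric.uniformContinuous_iff.1 huc ε hε
    have hr : 0 < min δ 1 := lt_min hδ one_pos
    let ρ : ContDiffBump (0 : Euc n) := ⟨min δ 1 / 2, min δ 1, by linarith, by linarith⟩
    let g : Euc n → ℝ := convolution (ρ.normed volume) φ (ContinuousLinearMap.lsmul ℝ ℝ) volume
    have hg : ContDiff ℝ ∞ g := ρ.hasCompactSupport_normed.contDiff_convolution_left _
      ρ.contDiff_normed hφ.continuous.locallyIntegrable
    have hgc : HasCompactSupport g :=
      ρ.hasCompactSupport_normed.convolution _ hφc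
    have hgder : ∀ x, fderiv ℝ g x = convolution (ρ.normed volume) (fderiv ℝ φ)
        (ContinuousLinearMap.lsmul ℝ ℝ) volume x := fun x =>
      (hφc.hasFDerivAt_convolution_right (ContinuousLinearMap.lsmul ℝ ℝ)
        ρ.continuous_normed.locallyIntegrable hφ x).fderiv
    have hdist : ∀ x, ‖fderiv ℝ g x - fderiv ℝ φ x‖ ≤ ε := by
      intro x
      rw [hgder, ← dist_eq_norm]
      refine ρ.dist_normed_convolution_le hcont.aestronglyMeasurable fun y hy => ?_
      exact (hδ' (lt_of_lt_of_le hy (min_le_left _ _))).le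
    have hsub : tsupport φ ⊆ K := self_subset_cthickening _
    have hgsub : tsupport g ⊆ K := by
      refine closure_minimal ?_ isClosed_cthickening
      refine (support_convolution_subset _).trans ?_
      rintro _ ⟨a, ha, b, hb, rfl⟩
      rw [ρ.support_normed_eq] at ha
      refine mem_cthickening_of_dist_le _ b 1 _ (subset_tsupport _ hb) ?_
      have : ‖a‖ < min δ 1 := mem_ball_zero_iff.1 ha
      simpa [dist_eq_norm] using this.le.trans (min_le_right _ _)
    have hout : ∀ x, x ∉ K → fderiv ℝ φ x (V x) - fderiv ℝ g x (V x) = 0 := by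
      intro x hx
      have h1 : fderiv ℝ φ x = 0 := by
        by_contra h0; exact hx (hsub (support_fderiv_subset ℝ h0))
      have h2 : fderiv ℝ g x = 0 := by
        by_contra h0; exact hx (hgsub (support_fderiv_subset ℝ h0))
      simp [h1, h2]
    have heq : ∫ x, fderiv ℝ φ x (V x) = ∫ x in K, (fderiv ℝ φ x (V x) - fderiv ℝ g x (V x)) := by
      rw [setIntegral_eq_integral_of_forall_compl_eq_zero hout,
        integral_sub (integrable_fderiv_apply hV hφ hφc)
          (integrable_fderiv_apply hV (hg.of_le (by norm_cast)) hgc), h g hg hgc,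
        sub_zero]
    rw [heq, ← integral_const_mul, ← Real.norm_eq_abs]
    refine norm_integral_le_of_norm_le (hVK.norm.const_mul ε) (ae_of_all _ fun x => ?_)
    rw [← _root_.sub_apply]
    refine (ContinuousLinearMap.le_opNorm _ _).trans ?_
    gcongr
    rw [norm_sub_rev]; exact hdist x
  have hlim : Filter.Tendsto (fun ε : ℝ => ε * ∫ x in K, ‖V x‖) (nhdsWithin 0 (Set.Ioi 0))
      (nhds 0) := by
    have : Filter.Tendsto (fun ε : ℝ => ε * ∫ x in K, ‖V x‖) (nhds 0) (nhds (0 * _)) :=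
      Filter.tendsto_id.mul_const _
    rw [zero_mul] at this
    exact this.mono_left nhdsWithin_le_nhds
  have := ge_of_tendsto hlim (Filter.eventually_of_mem self_mem_nhdsWithin fun ε hε => key ε hε)
  exact abs_nonpos_iff.1 this

/-- Dilates of a fixed bump function are cut-offs between `B_R` and `B_{2R}` with gradient of
order `1 / R`. -/
theorem exists_cutoff_s4 (n : ℕ) : ∃ c : ℝ, 0 ≤ c ∧ ∀ R : ℝ, 0 < R → ∃ η : Euc n → ℝ,
    ContDiff ℝ ∞ η ∧ HasCompactSupport η ∧ (∀ x, 0 ≤ η x) ∧ (∀ x, η x ≤ 1) ∧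
    (∀ x ∈ ball (0 : Euc n) R, η x = 1) ∧
    (∀ x, ‖fderiv ℝ η x‖ ≤ c / R) ∧
    (∀ x, x ∉ ball (0 : Euc n) (2 * R) \ ball 0 R → fderiv ℝ η x = 0) := by
  let ρ : ContDiffBump (0 : Euc n) := ⟨1, 2, one_pos, by norm_num⟩
  have hρ : ContDiff ℝ ∞ ρ := ρ.contDiff
  obtain ⟨c, hc⟩ := (hρ.continuous_fderiv (by simp)).bounded_above_of_compact_support
    (ρ.hasCompactSupport.fderiv ℝ)
  refine ⟨c, (norm_nonneg _).trans (hc 0), fun R hR =>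
    ⟨fun x => ρ (R⁻¹ • x), ?_, ?_, ?_, ?_, ?_, ?_, ?_⟩⟩
  · exact hρ.comp (contDiff_const_smul _)
  · exact ρ.hasCompactSupport.comp_smul (inv_ne_zero hR.ne')
  · exact fun x => ρ.nonneg
  · exact fun x => ρ.le_one
  · intro x hx
    refine ρ.one_of_mem_closedBall ?_
    have : ‖x‖ < R := by simpa using hx
    simp only [mem_closedBall, dist_zero_right, norm_smul, norm_inv, Real.norm_eq_abs,
      abs_of_pos hR]
    rw [inv_mul_le_iff₀ hR]; change ‖x‖ ≤ R * 1; linarith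
  · intro x
    rw [fderiv_comp_smul, norm_smul, norm_inv, Real.norm_eq_abs, abs_of_pos hR, div_eq_inv_mul]
    gcongr
    exact hc _
  · intro x hx
    rw [fderiv_comp_smul]
    suffices fderiv ℝ ρ (R⁻¹ • x) = 0 by rw [this, smul_zero]
    have hnorm : ‖R⁻¹ • x‖ = R⁻¹ * ‖x‖ := by
      rw [norm_smul, norm_inv, Real.norm_eq_abs, abs_of_pos hR]
    by_cases h1 : ‖x‖ < R
    · have : (R⁻¹ • x) ∈ ball (0 : Euc n) 1 := by
        rw [mem_ball_zero_iff, hnorm, inv_mul_lt_iff₀ hR]; linarith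
      have := ρ.eventuallyEq_one_of_mem_ball this
      rw [this.fderiv_eq]; exact fderiv_const_apply _
    · have h2 : 2 * R ≤ ‖x‖ := by
        by_contra h2
        exact hx ⟨by simpa using h2, by simpa using h1⟩
      have h0 : ρ (R⁻¹ • x) = 0 := ρ.zero_of_le_dist (by
        rw [dist_zero_right, hnorm, le_inv_mul_iff₀ hR]; change R * 2 ≤ _; linarith)
      exact IsLocalMin.fderiv_eq_zero (Filter.Eventually.of_forall fun y => by
        rw [h0]; exact ρ.nonneg)

/-- Young's inequality with an unoptimised constant. -/
theorem rpow_sub_one_mul_le {a b δ q : ℝ} (ha : 0 ≤ a) (hb : 0 ≤ b) (hδ : 0 < δ) (hq : 1 < q) :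
    a ^ (q - 1) * b ≤ δ * a ^ q + δ ^ (-(q - 1)) * b ^ q := by
  have hq0 : q - 1 + 1 ≠ 0 := by linarith
  have hsplit : ∀ y : ℝ, 0 ≤ y → y ^ q = y ^ (q - 1) * y := fun y hy => by
    conv_lhs => rw [← sub_add_cancel q 1, rpow_add_one' hy hq0]
  rcases le_total b (δ * a) with h | h
  · have : a ^ (q - 1) * b ≤ δ * a ^ q := by
      rw [hsplit a ha]
      calc a ^ (q - 1) * b ≤ a ^ (q - 1) * (δ * a) := by gcongr
        _ = _ := by ring
    have : 0 ≤ δ ^ (-(q - 1)) * b ^ q := by positivity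
    linarith
  · have : a ^ (q - 1) * b ≤ δ ^ (-(q - 1)) * b ^ q := by
      have h1 : a ≤ b / δ := by rw [le_div_iff₀ hδ]; linarith
      calc a ^ (q - 1) * b ≤ (b / δ) ^ (q - 1) * b := by
            gcongr
        _ = _ := by rw [hsplit b hb, div_rpow hb hδ.le, rpow_neg hδ.le]; ring
    have : 0 ≤ δ * a ^ q := by positivity
    linarith

theorem fderiv_apply_eq_inner_gradient {n : ℕ} (f : Euc n → ℝ) (x v : Euc n) :
    fderiv ℝ f x v = inner ℝ v (gradient f x) := by
  rw [real_inner_comm, gradient, InnerProductSpace.toDual_symm_apply]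

theorem continuous_gradient {n : ℕ} {u : Euc n → ℝ} (hu : ContDiff ℝ 1 u) :
    Continuous (gradient u) :=
  (InnerProductSpace.toDual ℝ (Euc n)).symm.continuous.comp (hu.continuous_fderiv one_ne_zero)

/-- The flux `x ↦ 𝒜(x, u, ∇u)` of a function of locally finite energy is locally integrable. -/
theorem IsNSGrowth.locallyIntegrable_flux {n : ℕ} {p : Euc n → ℝ}
    {𝒜 : Euc n → ℝ → Euc n → Euc n} {am bP : ℝ} (h𝒜 : IsNSGrowth p 𝒜 am bP)
    (hp : ∀ᵐ x ∂(volume : Measure (Euc n)), 1 < p x) {u : Euc n → ℝ} (hu : ContDiff ℝ 1 u)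
    (hloc : LocallyIntegrable (fun x => ‖gradient u x‖ ^ p x) (volume : Measure (Euc n))) :
    LocallyIntegrable (fun x => 𝒜 x (u x) (gradient u x)) (volume : Measure (Euc n)) := by
  obtain ⟨a, b, -, -, hab, -, hb⟩ := h𝒜.growth
  have hmeas : Measurable fun x => 𝒜 x (u x) (gradient u x) := by
    have h1 : Measurable (Function.uncurry fun (tξ : ℝ × Euc n) x => 𝒜 x tξ.1 tξ.2) :=
      measurable_uncurry_of_continuous_of_measurable h𝒜.cont fun tξ => h𝒜.meas tξ.1 tξ.2
    exact h1.comp ((hu.continuous.measurable.prodMk (continuous_gradient hu).measurable).prodMk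
      measurable_id)
  have hdom : LocallyIntegrable (fun x => bP * (1 + ‖gradient u x‖ ^ p x))
      (volume : Measure (Euc n)) := by
    exact ((locallyIntegrable_const (1 : ℝ)).add hloc).smul bP
  refine hdom.mono hmeas.aestronglyMeasurable ?_
  filter_upwards [hp] with x hx
  obtain ⟨h1, h2, h3⟩ := hab x
  have hbP : 0 ≤ bP := by linarith [h𝒜.am_pos]
  have hg := norm_nonneg (gradient u x)
  refine (hb x (u x) (gradient u x)).trans (le_trans ?_ (le_abs_self _))
  have hpow : ‖gradient u x‖ ^ (p x - 1) ≤ 1 + ‖gradient u x‖ ^ p x := by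
    rcases le_total ‖gradient u x‖ 1 with h | h
    · have := rpow_le_one hg h (by linarith : 0 ≤ p x - 1)
      have := rpow_nonneg hg (p x)
      linarith
    · have := rpow_le_rpow_of_exponent_le h (by linarith : p x - 1 ≤ p x)
      linarith
  gcongr

/-- Caccioppoli-type energy estimate, with an absorption parameter `δ`. -/
theorem IsAHarmonic.energy_estimate {n : ℕ} {p : Euc n → ℝ}
    {𝒜 : Euc n → ℝ → Euc n → Euc n} {am bP : ℝ} (h𝒜 : IsNSGrowth p 𝒜 am bP)
    (hp : ∀ᵐ x ∂(volume : Measure (Euc n)), 1 < p x) {u : Euc n → ℝ} (hu : IsAHarmonic p 𝒜 u)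
    {M : ℝ} (hbdd : ∀ x, |u x| ≤ M) {q : ℝ} (hq : 1 < q) {D : Set (Euc n)}
    (hD : MeasurableSet D) (hDfin : volume D ≠ ⊤)
    (hann : ∀ᵐ x ∂(volume.restrict D), p x = q)
    {η : Euc n → ℝ} (hη : ContDiff ℝ ∞ η) (hηc : HasCompactSupport η) (hη0 : ∀ x, 0 ≤ η x)
    {c : ℝ} (hc : ∀ x, ‖fderiv ℝ η x‖ ≤ c) (hηD : ∀ x, x ∉ D → fderiv ℝ η x = 0)
    {δ : ℝ} (hδ : 0 < δ) :
    am * ∫ x, η x ^ q * ‖gradient u x‖ ^ p x ≤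
      δ * (∫ x in D, η x ^ q * ‖gradient u x‖ ^ p x) +
        δ ^ (-(q - 1)) * (q * M * bP * c) ^ q * volume.real D := by
  obtain ⟨huC, hloc, htest⟩ := hu
  obtain ⟨a, b, -, -, hab, ha, hb⟩ := h𝒜.growth
  set V : Euc n → Euc n := fun x => 𝒜 x (u x) (gradient u x)
  have hV : LocallyIntegrable V volume := h𝒜.locallyIntegrable_flux hp huC hloc
  have hM : 0 ≤ M := (abs_nonneg _).trans (hbdd 0)
  have hc0 : 0 ≤ c := (norm_nonneg _).trans (hc 0)
  have hbP : 0 ≤ bP := by obtain ⟨h1, h2, h3⟩ := hab 0; linarith [h𝒜.am_pos]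
  have hηq : ContDiff ℝ 1 fun x => η x ^ q := by
    have h1 : ContDiff ℝ 1 fun y : ℝ => y ^ q :=
      mod_cast contDiff_rpow_const_of_le (n := 1) (by simpa using hq.le)
    exact h1.comp (hη.of_le (by norm_cast))
  have hηqc : HasCompactSupport fun x => η x ^ q :=
    hηc.comp_left (g := fun y : ℝ => y ^ q) (zero_rpow (by linarith))
  have hφ : ContDiff ℝ 1 fun x => u x * η x ^ q := huC.mul hηq
  have hφc : HasCompactSupport fun x => u x * η x ^ q := hηqc.mul_left
  have hzero : ∫ x, fderiv ℝ (fun x => u x * η x ^ q) x (V x) = 0 := by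
    refine integral_fderiv_apply_eq_zero_of_contDiff_one hV (fun ψ h1 h2 => ?_) hφ hφc
    simpa only [fderiv_apply_eq_inner_gradient] using htest ψ h1 h2
  have hφint := integrable_fderiv_apply hV hφ hφc
  have hE : Integrable fun x => η x ^ q * ‖gradient u x‖ ^ p x :=
    hloc.integrable_smul_left_of_hasCompactSupport hηq.continuous hηqc
  set C : ℝ := δ ^ (-(q - 1)) * (q * M * bP * c) ^ q with hC
  have hCint : IntegrableOn (fun _ : Euc n => C) D := integrableOn_const hDfin
  have hDint : IntegrableOn (fun x => δ * (η x ^ q * ‖gradient u x‖ ^ p x) + C) D :=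
    (hE.integrableOn.const_mul δ).add hCint
  have hpt : ∀ᵐ x ∂(volume : Measure (Euc n)), am * (η x ^ q * ‖gradient u x‖ ^ p x) -
      D.indicator (fun x => δ * (η x ^ q * ‖gradient u x‖ ^ p x) + C) x ≤
      fderiv ℝ (fun x => u x * η x ^ q) x (V x) := by
    filter_upwards [(ae_restrict_iff' hD).1 hann] with x hx
    have hg := norm_nonneg (gradient u x)
    have hder : fderiv ℝ (fun x => u x * η x ^ q) x (V x) =
        η x ^ q * inner ℝ (V x) (gradient u x) +
          u x * (q * η x ^ (q - 1) * fderiv ℝ η x (V x)) := by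
      have h1 : HasFDerivAt u (fderiv ℝ u x) x :=
        (huC.differentiable one_ne_zero x).hasFDerivAt
      have h2 : HasFDerivAt η (fderiv ℝ η x) x := (hη.differentiable (by simp) x).hasFDerivAt
      have h3 : HasFDerivAt (fun x => u x * η x ^ q) _ x := h1.mul (h2.rpow_const (p := q) (Or.inr hq.le))
      rw [h3.fderiv, ← fderiv_apply_eq_inner_gradient]
      simp
      ring
    have hmain : am * (η x ^ q * ‖gradient u x‖ ^ p x) ≤
        η x ^ q * inner ℝ (V x) (gradient u x) := by
      have h1 : am * ‖gradient u x‖ ^ p x ≤ inner ℝ (V x) (gradient u x) :=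
        le_trans (by gcongr; exact (hab x).1) (ha x (u x) (gradient u x))
      have := mul_le_mul_of_nonneg_left h1 (rpow_nonneg (hη0 x) q)
      linarith
    rw [hder]
    by_cases hxD : x ∈ D
    · rw [Set.indicator_of_mem hxD]
      have hpx := hx hxD
      have hVx : ‖V x‖ ≤ bP * ‖gradient u x‖ ^ (q - 1) := by
        refine (hb x (u x) (gradient u x)).trans ?_
        rw [hpx]
        gcongr
        exact (hab x).2.2
      have herr : |u x * (q * η x ^ (q - 1) * fderiv ℝ η x (V x))| ≤
          (η x * ‖gradient u x‖) ^ (q - 1) * (q * M * bP * c) := by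
        have h1 : |fderiv ℝ η x (V x)| ≤ c * (bP * ‖gradient u x‖ ^ (q - 1)) :=
          ((fderiv ℝ η x).le_opNorm (V x)).trans (mul_le_mul (hc x) hVx (norm_nonneg _) hc0)
        have h2 := rpow_nonneg (hη0 x) (q - 1)
        have h3 : 0 ≤ q * η x ^ (q - 1) := by positivity
        rw [abs_mul, abs_mul, abs_of_nonneg h3, mul_rpow (hη0 x) hg]
        calc |u x| * (q * η x ^ (q - 1) * |fderiv ℝ η x (V x)|)
            ≤ M * (q * η x ^ (q - 1) * (c * (bP * ‖gradient u x‖ ^ (q - 1)))) := by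
              gcongr; exact hbdd x
          _ = _ := by ring
      have hyoung := rpow_sub_one_mul_le (mul_nonneg (hη0 x) hg)
        (by positivity : 0 ≤ q * M * bP * c) hδ hq
      rw [mul_rpow (hη0 x) hg (z := q), ← hC] at hyoung
      have := neg_abs_le (u x * (q * η x ^ (q - 1) * fderiv ℝ η x (V x)))
      rw [hpx] at hmain ⊢
      linarith
    · rw [Set.indicator_of_notMem hxD, hηD x hxD]
      simpa using hmain
  have hmono := integral_mono_ae ((hE.const_mul am).sub ((integrable_indicator_iff hD).2 hDint))
    hφint hpt
  rw [hzero] at hmono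
  simp only [Pi.sub_apply] at hmono
  rw [integral_sub (hE.const_mul am) ((integrable_indicator_iff hD).2 hDint),
    integral_indicator hD, integral_add (hE.integrableOn.const_mul δ) hCint,
    integral_const_mul, integral_const_mul, setIntegral_const, smul_eq_mul] at hmono
  linarith

/-- Energy estimate on balls whose surrounding dyadic annulus carries a constant exponent
`q ≥ n`; the constant does not depend on the radius. -/
theorem IsAHarmonic.exists_ball_energy_estimate {n : ℕ} {p : Euc n → ℝ}
    {𝒜 : Euc n → ℝ → Euc n → Euc n} {am bP : ℝ} (h𝒜 : IsNSGrowth p 𝒜 am bP)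
    (hp : ∀ᵐ x ∂(volume : Measure (Euc n)), 1 < p x) {u : Euc n → ℝ} (hu : IsAHarmonic p 𝒜 u)
    {M : ℝ} (hbdd : ∀ x, |u x| ≤ M) {q : ℝ} (hq : 1 < q) (hqn : (n : ℝ) ≤ q) :
    ∃ K : ℝ, ∀ R : ℝ, 1 ≤ R →
      (∀ᵐ x ∂(volume.restrict (ball (0 : Euc n) (2 * R) \ ball 0 R)), p x = q) →
      ∃ ψ : Euc n → ℝ, (∀ x, 0 ≤ ψ x) ∧ (∀ x, ψ x ≤ 1) ∧ (∀ x ∈ ball (0 : Euc n) R, ψ x = 1) ∧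
        Integrable (fun x => ψ x * ‖gradient u x‖ ^ p x) ∧
        ∀ δ : ℝ, 0 < δ → am * ∫ x, ψ x * ‖gradient u x‖ ^ p x ≤
          δ * (∫ x in ball (0 : Euc n) (2 * R) \ ball 0 R, ψ x * ‖gradient u x‖ ^ p x) +
            δ ^ (-(q - 1)) * K := by
  obtain ⟨c, hc0, hc⟩ := exists_cutoff_s4 n
  have hM : 0 ≤ M := (abs_nonneg _).trans (hbdd 0)
  have hbP : 0 ≤ bP := by
    obtain ⟨a, b, -, -, hab, -⟩ := h𝒜.growth
    obtain ⟨h1, h2, h3⟩ := hab 0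
    linarith [h𝒜.am_pos]
  refine ⟨(q * M * bP * c) ^ q * (2 ^ n * volume.real (ball (0 : Euc n) 1)), fun R hR hann => ?_⟩
  have hR0 : 0 < R := by linarith
  obtain ⟨η, hη, hηc, hη0, hη1, hηone, hηc', hηD⟩ := hc R hR0
  have hηq : Continuous fun x => η x ^ q :=
    hη.continuous.rpow_const fun x => Or.inr (by linarith)
  have hηqc : HasCompactSupport fun x => η x ^ q :=
    hηc.comp_left (g := fun y : ℝ => y ^ q) (zero_rpow (by linarith))
  refine ⟨fun x => η x ^ q, fun x => rpow_nonneg (hη0 x) q,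
    fun x => rpow_le_one (hη0 x) (hη1 x) (by linarith),
    fun x hx => by simp [hηone x hx],
    hu.2.1.integrable_smul_left_of_hasCompactSupport hηq hηqc, fun δ hδ => ?_⟩
  have hfin : volume (ball (0 : Euc n) (2 * R) \ ball 0 R) ≠ ⊤ :=
    measure_ne_top_of_subset Set.sdiff_subset measure_ball_lt_top.ne
  refine (hu.energy_estimate h𝒜 hp hbdd hq (measurableSet_ball.diff measurableSet_ball)
    hfin hann hη hηc hη0 hηc' hηD hδ).trans ?_
  have hvol : volume.real (ball (0 : Euc n) (2 * R) \ ball 0 R) ≤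
      (2 * R) ^ n * volume.real (ball (0 : Euc n) 1) := by
    refine (measureReal_mono Set.sdiff_subset measure_ball_lt_top.ne).trans_eq ?_
    simp [measureReal_def, Measure.addHaar_ball_of_pos volume (0 : Euc n)
      (by linarith : 0 < 2 * R), ENNReal.toReal_ofReal, hR0.le]
  have hRq : R ^ n ≤ R ^ q := by
    rw [← rpow_natCast]; exact rpow_le_rpow_of_exponent_le hR hqn
  have hRq0 : 0 < R ^ q := rpow_pos_of_pos hR0 q
  rw [mul_assoc (δ ^ _)]
  gcongr δ * _ + δ ^ (-(q - 1)) * ?_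
  have hpos : 0 ≤ q * M * bP * c := by positivity
  rw [← mul_div_assoc, div_rpow hpos hR0.le]
  calc (q * M * bP * c) ^ q / R ^ q * volume.real (ball (0 : Euc n) (2 * R) \ ball 0 R)
      ≤ (q * M * bP * c) ^ q / R ^ q * ((2 * R) ^ n * volume.real (ball (0 : Euc n) 1)) := by
        gcongr
    _ = (q * M * bP * c) ^ q * (2 ^ n * volume.real (ball (0 : Euc n) 1)) * (R ^ n / R ^ q) := by
        rw [mul_pow]; ring
    _ ≤ _ := mul_le_of_le_one_right (by positivity) ((div_le_one hRq0).2 hRq)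

/-- Corollary 3.6: let `n ≥ 2` and suppose `p ≡ q` a.e. on annuli `B_{2R_k}∖B_{R_k}`
with `R_k → ∞`, where `n ≤ q ≤ p⁺` is constant. Then every bounded `𝒜`-harmonic
function in `ℝⁿ` is constant. -/
theorem liouville_bounded_q_ge_n {n : ℕ} (hn : 2 ≤ n) (p : Euc n → ℝ) (pm pP : ℝ)
    (hp : IsVarExp p pm pP)
    (𝒜 : Euc n → ℝ → Euc n → Euc n) (am bP : ℝ)
    (h𝒜 : IsNSGrowth p 𝒜 am bP)
    (R : ℕ → ℝ) (hRmono : StrictMono R)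
    (hRtop : Filter.Tendsto R Filter.atTop Filter.atTop)
    (q : ℝ) (hqn : (n : ℝ) ≤ q) (hqP : q ≤ pP)
    (hann : ∀ k, ∀ᵐ x ∂(volume.restrict
      (Metric.ball (0 : Euc n) (2 * R k) \ Metric.ball 0 (R k))), p x = q)
    (u : Euc n → ℝ) (hu : IsAHarmonic p 𝒜 u)
    (M : ℝ) (hbdd : ∀ x, |u x| ≤ M) :
    ∃ c : ℝ, ∀ x, u x = c := by
  have hq : 1 < q := lt_of_lt_of_le (by exact_mod_cast hn) hqn
  have hp1 : ∀ᵐ x ∂(volume : Measure (Euc n)), 1 < p x := by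
    filter_upwards [hp.ae_lb] with x hx using lt_of_lt_of_le hp.one_lt hx
  have ham := h𝒜.am_pos
  obtain ⟨K, hK⟩ := hu.exists_ball_energy_estimate h𝒜 hp1 hbdd hq hqn
  set E : Euc n → ℝ := fun x => ‖gradient u x‖ ^ p x
  have hE0 : ∀ x, 0 ≤ E x := fun x => rpow_nonneg (norm_nonneg _) _
  have hcover : AECover (volume : Measure (Euc n)) Filter.atTop fun k => ball (0 : Euc n) (R k) :=
    aecover_ball hRtop
  have hEloc : ∀ r : ℝ, IntegrableOn E (ball (0 : Euc n) r) := fun r =>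
    (hu.2.1.integrableOn_isCompact (isCompact_closedBall 0 r)).mono_set ball_subset_closedBall
  have hball : ∀ (r : ℝ) (ψ : Euc n → ℝ), (∀ x, 0 ≤ ψ x) →
      (∀ x ∈ ball (0 : Euc n) r, ψ x = 1) → Integrable (fun x => ψ x * E x) →
      ∫ x in ball (0 : Euc n) r, E x ≤ ∫ x, ψ x * E x := by
    intro r ψ hψ0 hψ1 hψi
    calc ∫ x in ball (0 : Euc n) r, E x = ∫ x in ball (0 : Euc n) r, ψ x * E x :=
          setIntegral_congr_fun measurableSet_ball fun x hx => by simp [hψ1 x hx]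
      _ ≤ _ := setIntegral_le_integral hψi (ae_of_all _ fun x => mul_nonneg (hψ0 x) (hE0 x))
  have hEint : Integrable E := by
    refine hcover.integrable_of_integral_bounded_of_nonneg_ae
      ((am / 2) ^ (-(q - 1)) * K / (am / 2)) (fun k => hEloc _) (ae_of_all _ hE0) ?_
    filter_upwards [hRtop.eventually_ge_atTop 1] with k hk
    obtain ⟨ψ, hψ0, -, hψ1, hψi, hψ⟩ := hK (R k) hk (hann k)
    refine (hball _ ψ hψ0 hψ1 hψi).trans ?_
    rw [le_div_iff₀ (by linarith)]
    have h1 := hψ (am / 2) (by linarith)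
    have h2 : ∫ x in ball (0 : Euc n) (2 * R k) \ ball 0 (R k), ψ x * E x ≤ ∫ x, ψ x * E x :=
      setIntegral_le_integral hψi (ae_of_all _ fun x => mul_nonneg (hψ0 x) (hE0 x))
    have h3 := mul_le_mul_of_nonneg_left h2 (by linarith : 0 ≤ am / 2)
    linarith
  have hlim := hcover.integral_tendsto_of_countably_generated hEint
  have hbound : ∀ δ : ℝ, 0 < δ → am * ∫ x, E x ≤ δ ^ (-(q - 1)) * K := by
    intro δ hδ
    have hl : Filter.Tendsto (fun k => am * ∫ x in ball (0 : Euc n) (R k), E x) Filter.atTop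
        (nhds (am * ∫ x, E x)) := hlim.const_mul am
    have hr : Filter.Tendsto (fun k => δ * ((∫ x, E x) - ∫ x in ball (0 : Euc n) (R k), E x) +
        δ ^ (-(q - 1)) * K) Filter.atTop (nhds (δ ^ (-(q - 1)) * K)) := by
      simpa using ((hlim.const_sub (∫ x, E x)).const_mul δ).add_const (δ ^ (-(q - 1)) * K)
    refine le_of_tendsto_of_tendsto hl hr ?_
    filter_upwards [hRtop.eventually_ge_atTop 1] with k hk
    obtain ⟨ψ, hψ0, hψle, hψ1, hψi, hψ⟩ := hK (R k) hk (hann k)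
    have h1 := mul_le_mul_of_nonneg_left (hball _ ψ hψ0 hψ1 hψi) ham.le
    have h2 : ∫ x in ball (0 : Euc n) (2 * R k) \ ball 0 (R k), ψ x * E x ≤
        (∫ x, E x) - ∫ x in ball (0 : Euc n) (R k), E x := by
      rw [← setIntegral_compl measurableSet_ball hEint]
      refine (integral_mono hψi.integrableOn hEint.integrableOn fun x =>
        mul_le_of_le_one_left (hE0 x) (hψle x)).trans ?_
      exact setIntegral_mono_set hEint.integrableOn (ae_of_all _ hE0)
        (Set.sdiff_subset_compl _ _).eventuallyLE
    have h3 := mul_le_mul_of_nonneg_left h2 hδ.le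
    have h4 := hψ δ hδ
    linarith
  have hzero : ∫ x, E x = 0 := by
    have ht : Filter.Tendsto (fun δ : ℝ => δ ^ (-(q - 1)) * K) Filter.atTop (nhds 0) := by
      simpa using (tendsto_rpow_neg_atTop (by linarith : 0 < q - 1)).mul_const K
    have h1 : am * ∫ x, E x ≤ 0 := ge_of_tendsto ht
      ((Filter.eventually_gt_atTop 0).mono fun δ hδ => hbound δ hδ)
    have h2 : 0 ≤ ∫ x, E x := integral_nonneg hE0
    nlinarith
  have hae : gradient u =ᵐ[volume] fun _ => (0 : Euc n) := by
    filter_upwards [(integral_eq_zero_iff_of_nonneg hE0 hEint).1 hzero] with x hx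
    exact norm_eq_zero.1 ((rpow_eq_zero_iff_of_nonneg (norm_nonneg _)).1 hx).1
  have hgrad : gradient u = fun _ => (0 : Euc n) :=
    ((continuous_gradient hu.1).ae_eq_iff_eq volume continuous_const).1 hae
  refine ⟨u 0, fun x => is_const_of_fderiv_eq_zero (hu.1.differentiable one_ne_zero) (fun y => ?_)
    x 0⟩
  ext v
  rw [fderiv_apply_eq_inner_gradient, hgrad]
  simp

end
end
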